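/- For every real p > 1/2 and every f ∈ C¹_poly(ℝⁿ), the L^{2p}(γ) Poincaré inequality holds: (∫ |f(x) − f̄|^{2p} dγ(x))^{1/(2p)} ≤ (π/2) · m(2p)^{1/(2p)} · (∫ |∇f(x)|^{2p} dγ(x))^{1/(2p)}, where m(2p) = ∫ |z|^{2p} dγ₁(z) is the 2p-th absolute moment of the standard Gaussian distribution. -/

import Mathlib

open MeasureTheory Real
open scoped RealInnerProductSpace BigOperators

noncomputable section

/-- The standard Gaussian measure on `ℝⁿ`, with density
`(2π)^(-n/2) exp(-|x|²/2)` with respect to Lebesgue measure. -/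
def gaussianMeasure (n : ℕ) : Measure (EuclideanSpace ℝ (Fin n)) :=
  volume.withDensity fun x => ENNReal.ofReal ((2 * π) ^ (-(n : ℝ) / 2) * Real.exp (-‖x‖ ^ 2 / 2))

/-- `C^k_poly(ℝⁿ)`: `C^k` functions which, together with all derivatives up to
order `k`, are bounded by a polynomial. -/
def CPoly (k n : ℕ) (f : EuclideanSpace ℝ (Fin n) → ℝ) : Prop :=
  ContDiff ℝ k f ∧
    ∀ i, i ≤ k → ∃ (C : ℝ) (m : ℕ), ∀ x, ‖iteratedFDeriv ℝ i f x‖ ≤ C * (1 + ‖x‖) ^ m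

/-- The `i`-th partial derivative. -/
def partialDeriv {n : ℕ} (i : Fin n) (f : EuclideanSpace ℝ (Fin n) → ℝ)
    (x : EuclideanSpace ℝ (Fin n)) : ℝ :=
  fderiv ℝ f x (EuclideanSpace.single i 1)

/-- The Laplacian. -/
def laplacian {n : ℕ} (f : EuclideanSpace ℝ (Fin n) → ℝ) (x : EuclideanSpace ℝ (Fin n)) : ℝ :=
  ∑ i : Fin n, partialDeriv i (partialDeriv i f) x

/-- The Ornstein–Uhlenbeck operator `δ·∇ f (x) = x·∇f(x) − Δf(x)`. -/
def ouOperator {n : ℕ} (f : EuclideanSpace ℝ (Fin n) → ℝ) (x : EuclideanSpace ℝ (Fin n)) : ℝ :=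
  ⟪x, gradient f x⟫ - laplacian f x

/-- The Ornstein–Uhlenbeck semigroup given by the Mehler formula. -/
def ouSemigroup (n : ℕ) (t : ℝ) (f : EuclideanSpace ℝ (Fin n) → ℝ)
    (x : EuclideanSpace ℝ (Fin n)) : ℝ :=
  ∫ y, f (Real.exp (-t) • x + Real.sqrt (1 - Real.exp (-2 * t)) • y) ∂gaussianMeasure n

/-- A Young function: the primitive of a continuous, strictly increasing function
`φ` with `φ(0) = 0` and `φ(u) → ∞`. -/
def IsYoung (Φ : ℝ → ℝ) : Prop :=
  ∃ φ : ℝ → ℝ, ContinuousOn φ (Set.Ici 0) ∧ StrictMonoOn φ (Set.Ici 0) ∧ φ 0 = 0 ∧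
    Filter.Tendsto φ Filter.atTop Filter.atTop ∧
    ∀ x, 0 ≤ x → Φ x = ∫ u in (0:ℝ)..x, φ u

/-- The Luxemburg norm of `f` in the Orlicz space `L_Φ(γ)` over the Gaussian space. -/
def luxNorm (n : ℕ) (Φ : ℝ → ℝ) (f : EuclideanSpace ℝ (Fin n) → ℝ) : ℝ :=
  sInf {α : ℝ | 0 < α ∧ ∫ x, Φ (|f x| / α) ∂gaussianMeasure n ≤ 1}

end

open ProbabilityTheory
open scoped ENNReal

/-- The Gaussian measure with explicit density is Mathlib's standard Gaussian. -/
lemma gaussianMeasure_eq_stdGaussian (n : ℕ) :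
    gaussianMeasure n = stdGaussian (EuclideanSpace ℝ (Fin n)) := by
  have hpos : ∀ x : EuclideanSpace ℝ (Fin n),
      0 ≤ (2 * π) ^ (-(n : ℝ) / 2) * Real.exp (-‖x‖ ^ 2 / 2) := fun x ↦ by positivity
  have hint : ∀ t : EuclideanSpace ℝ (Fin n),
      ∫ x, Complex.exp ((⟪x, t⟫ : ℝ) * Complex.I) ∂gaussianMeasure n
        = Complex.exp (-‖t‖ ^ 2 / 2) := by
    intro t
    rw [gaussianMeasure, integral_withDensity_eq_integral_toReal_smul (by fun_prop) (by simp)]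
    have hc : ((2 * π : ℝ) : ℂ) ^ ((n : ℂ) / 2) ≠ 0 := by
      rw [Ne, Complex.cpow_eq_zero_iff]
      simp [Real.pi_ne_zero]
    have key := GaussianFourier.integral_cexp_neg_mul_sq_norm_add (b := 1 / 2) (by norm_num) Complex.I t
    have h2 : ∀ x : EuclideanSpace ℝ (Fin n),
        (ENNReal.ofReal ((2 * π) ^ (-(n : ℝ) / 2) * Real.exp (-‖x‖ ^ 2 / 2))).toReal •
          Complex.exp ((⟪x, t⟫ : ℝ) * Complex.I)
        = ((2 * π : ℝ) : ℂ) ^ (-((n : ℂ) / 2)) *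
          Complex.exp (-(1 / 2) * ‖x‖ ^ 2 + Complex.I * (⟪t, x⟫ : ℝ)) := by
      intro x
      rw [ENNReal.toReal_ofReal (hpos x), Complex.real_smul, Complex.exp_add]
      push_cast
      rw [Complex.ofReal_cpow (by positivity), real_inner_comm]
      push_cast
      ring_nf
    simp_rw [h2]
    rw [integral_const_mul, key, ← mul_assoc, finrank_euclideanSpace_fin]
    rw [show (π : ℂ) / (1 / 2) = ((2 * π : ℝ) : ℂ) by push_cast; ring, Complex.cpow_neg,
      inv_mul_cancel₀ hc, one_mul]
    congr 1
    rw [Complex.I_sq]; ring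
  have hfin : IsFiniteMeasure (gaussianMeasure n) := by
    refine isFiniteMeasure_withDensity_ofReal ?_
    have : Integrable fun x : EuclideanSpace ℝ (Fin n) ↦ Real.exp (-‖x‖ ^ 2 / 2) := by
      have h := GaussianFourier.integrable_cexp_neg_mul_sq_norm_add (b := 1 / 2)
        (by norm_num) 0 (0 : EuclideanSpace ℝ (Fin n))
      refine h.norm.congr (Filter.Eventually.of_forall fun x ↦ ?_)
      simp only [Complex.norm_exp]
      congr 1
      simp [← Complex.ofReal_pow]
      ring
    exact (this.const_mul _).2
  refine Measure.ext_of_charFun ?_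
  ext t
  rw [charFun_apply, hint, charFun_stdGaussian]

/-- Jensen's inequality for powers, on a finite measure space. -/
lemma lintegral_rpow_le_measure_univ_rpow_mul {α : Type*} [MeasurableSpace α] (μ : Measure α)
    {q : ℝ} (hq : 1 < q) {g : α → ℝ≥0∞} (hg : AEMeasurable g μ) :
    (∫⁻ a, g a ∂μ) ^ q ≤ μ Set.univ ^ (q - 1) * ∫⁻ a, g a ^ q ∂μ := by
  have hq0 : 0 < q := by linarith
  have hc := Real.HolderConjugate.conjExponent hq
  have h := ENNReal.lintegral_mul_le_Lp_mul_Lq μ hc hg (aemeasurable_const (b := (1 : ℝ≥0∞)))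
  simp only [Pi.mul_apply, mul_one, ENNReal.one_rpow, lintegral_const, one_mul] at h
  calc (∫⁻ a, g a ∂μ) ^ q
      ≤ ((∫⁻ a, g a ^ q ∂μ) ^ (1 / q) * μ Set.univ ^ (1 / q.conjExponent)) ^ q := by gcongr
    _ = μ Set.univ ^ (q - 1) * ∫⁻ a, g a ^ q ∂μ := by
      rw [ENNReal.mul_rpow_of_nonneg _ _ hq0.le, ← ENNReal.rpow_mul, ← ENNReal.rpow_mul, mul_comm]
      congr 1
      · congr 1
        rw [Real.conjExponent]
        have : q - 1 ≠ 0 := by linarith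
        field_simp
      · rw [one_div, inv_mul_cancel₀ hq0.ne', ENNReal.rpow_one]

/-- The increment of `f` between two points, along the arc `θ ↦ cos θ x + sin θ y`. -/
lemma enorm_sub_le_lintegral_rotation {E : Type*} [NormedAddCommGroup E]
    [NormedSpace ℝ E] {f : E → ℝ} (hf : ContDiff ℝ 1 f) (z : E × E) :
    ‖f z.1 - f z.2‖ₑ ≤ ∫⁻ θ in Set.Ioc 0 (π / 2),
      ‖fderiv ℝ f (ContinuousLinearMap.rotation θ z).1 (ContinuousLinearMap.rotation θ z).2‖ₑ := by
  have hd : Differentiable ℝ f := hf.differentiable (by simp)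
  have hfd : Continuous (fderiv ℝ f) := hf.continuous_fderiv (by simp)
  simp only [ContinuousLinearMap.rotation_apply]
  have hder : ∀ θ : ℝ, HasDerivAt (fun θ ↦ f (Real.cos θ • z.1 + Real.sin θ • z.2))
      (fderiv ℝ f (Real.cos θ • z.1 + Real.sin θ • z.2)
        (-Real.sin θ • z.1 + Real.cos θ • z.2)) θ := fun θ ↦
    (hd _).hasFDerivAt.comp_hasDerivAt θ
      (((Real.hasDerivAt_cos θ).smul_const z.1).add ((Real.hasDerivAt_sin θ).smul_const z.2))
  have hcont : Continuous fun θ : ℝ ↦ fderiv ℝ f (Real.cos θ • z.1 + Real.sin θ • z.2)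
      (-Real.sin θ • z.1 + Real.cos θ • z.2) := by fun_prop
  have hFTC := intervalIntegral.integral_eq_sub_of_hasDerivAt (fun θ _ ↦ hder θ)
    (hcont.intervalIntegrable 0 (π / 2))
  simp only [Real.cos_pi_div_two, Real.sin_pi_div_two, Real.cos_zero, Real.sin_zero, zero_smul,
    one_smul, zero_add, add_zero] at hFTC
  rw [← enorm_neg, neg_sub, ← hFTC, intervalIntegral.integral_of_le (by positivity)]
  exact enorm_integral_le_lintegral_enorm _

section StdGaussian

variable {E : Type*} [NormedAddCommGroup E] [InnerProductSpace ℝ E] [FiniteDimensional ℝ E]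
  [MeasurableSpace E] [BorelSpace E]

/-- The moments of a linear form under the standard Gaussian measure. -/
lemma lintegral_enorm_dual_rpow_stdGaussian (L : StrongDual ℝ E) {q : ℝ} (hq : 0 ≤ q) :
    ∫⁻ y, ‖L y‖ₑ ^ q ∂stdGaussian E = ‖L‖ₑ ^ q * ∫⁻ z, ‖z‖ₑ ^ q ∂gaussianReal 0 1 := by
  have hmap : (stdGaussian E).map L = (gaussianReal 0 1).map (‖L‖ * ·) := by
    rw [IsGaussian.map_eq_gaussianReal, integral_strongDual_stdGaussian,
      variance_dual_stdGaussian, gaussianReal_map_const_mul]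
    congr 1
    · simp
    · ext; simp
  have h1 : ∫⁻ y, ‖L y‖ₑ ^ q ∂stdGaussian E = ∫⁻ z, ‖z‖ₑ ^ q ∂((stdGaussian E).map L) :=
    (lintegral_map (f := fun z : ℝ ↦ ‖z‖ₑ ^ q) (by fun_prop) (by fun_prop)).symm
  rw [h1, hmap, lintegral_map (by fun_prop) (by fun_prop), ← lintegral_const_mul _ (by fun_prop)]
  refine lintegral_congr fun z ↦ ?_
  rw [enorm_mul, enorm_norm, ENNReal.mul_rpow_of_nonneg _ _ hq]

/-- A measurable function of polynomial growth lies in every `L^q` of the standard Gaussian. -/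
lemma memLp_stdGaussian_of_norm_le {F : Type*} [NormedAddCommGroup F] {g : E → F}
    (hg : AEStronglyMeasurable g (stdGaussian E)) {C : ℝ} {m : ℕ}
    (h : ∀ x, ‖g x‖ ≤ C * (1 + ‖x‖) ^ m) {q : ℝ≥0∞} (hq : q ≠ ∞) :
    MemLp g q (stdGaussian E) := by
  have h0 : MemLp (fun x : E ↦ ‖x‖) (m * q) (stdGaussian E) :=
    (IsGaussian.memLp_id (stdGaussian E) _ (ENNReal.mul_ne_top (by simp) hq)).norm
  have h1 : MemLp (fun x : E ↦ 1 + ‖x‖) (m * q) (stdGaussian E) :=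
    (memLp_const (1 : ℝ)).add h0
  have h2 : MemLp (fun x : E ↦ C * (1 + ‖x‖) ^ m) q (stdGaussian E) := by
    refine MemLp.const_mul ?_ C
    rcases eq_or_ne m 0 with rfl | hm
    · simpa using memLp_const (1 : ℝ)
    · have h3 := h1.norm_rpow_div (m : ℝ≥0∞)
      rw [mul_comm, ENNReal.mul_div_cancel_right (by simpa using hm) (by simp)] at h3
      refine h3.congr_norm (by fun_prop) (Filter.Eventually.of_forall fun x ↦ ?_)
      simp
  exact h2.mono' hg (Filter.Eventually.of_forall h)

/-- Pisier's inequality: the `L^q` Poincaré inequality in terms of two independent standard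
Gaussian vectors. -/
lemma lintegral_enorm_sub_rpow_le {f : E → ℝ} (hf : ContDiff ℝ 1 f) {q : ℝ} (hq : 1 < q) :
    ∫⁻ z, ‖f z.1 - f z.2‖ₑ ^ q ∂(stdGaussian E).prod (stdGaussian E) ≤
      ENNReal.ofReal (π / 2) ^ q * ((∫⁻ z, ‖z‖ₑ ^ q ∂gaussianReal 0 1) *
        ∫⁻ x, ‖fderiv ℝ f x‖ₑ ^ q ∂stdGaussian E) := by
  have hfd : Continuous (fderiv ℝ f) := hf.continuous_fderiv (by simp)
  set G : E × E → ℝ≥0∞ := fun z ↦ ‖fderiv ℝ f z.1 z.2‖ₑ ^ q with hG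
  have hGm : Measurable G := by
    have : Continuous fun z : E × E ↦ fderiv ℝ f z.1 z.2 := by fun_prop
    exact this.measurable.enorm.pow_const q
  have hrot : Continuous fun a : (E × E) × ℝ ↦ ContinuousLinearMap.rotation a.2 a.1 := by
    simp only [ContinuousLinearMap.rotation_apply]; fun_prop
  have hGint : ∫⁻ z, G z ∂(stdGaussian E).prod (stdGaussian E) =
      (∫⁻ z, ‖z‖ₑ ^ q ∂gaussianReal 0 1) * ∫⁻ x, ‖fderiv ℝ f x‖ₑ ^ q ∂stdGaussian E := by
    rw [lintegral_prod _ hGm.aemeasurable, mul_comm,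
      ← lintegral_mul_const _ (hfd.measurable.enorm.pow_const q)]
    exact lintegral_congr fun x ↦
      lintegral_enorm_dual_rpow_stdGaussian (fderiv ℝ f x) (zero_le_one.trans hq.le)
  have hGrot : ∀ θ : ℝ, ∫⁻ z, G (ContinuousLinearMap.rotation θ z)
      ∂(stdGaussian E).prod (stdGaussian E) = ∫⁻ z, G z ∂(stdGaussian E).prod (stdGaussian E) := by
    intro θ
    rw [← lintegral_map hGm (by fun_prop), IsGaussian.map_rotation_eq_self (by simp)]
  have hpt : ∀ z : E × E, ‖f z.1 - f z.2‖ₑ ^ q ≤ ENNReal.ofReal (π / 2) ^ (q - 1) *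
      ∫⁻ θ in Set.Ioc 0 (π / 2), G (ContinuousLinearMap.rotation θ z) := by
    intro z
    have hm : Continuous fun θ : ℝ ↦ fderiv ℝ f (ContinuousLinearMap.rotation θ z).1
        (ContinuousLinearMap.rotation θ z).2 := by
      simp only [ContinuousLinearMap.rotation_apply]; fun_prop
    refine (ENNReal.rpow_le_rpow (enorm_sub_le_lintegral_rotation hf z) (by linarith)).trans ?_
    refine (lintegral_rpow_le_measure_univ_rpow_mul _ hq hm.measurable.enorm.aemeasurable).trans ?_
    simp [hG]
  calc ∫⁻ z, ‖f z.1 - f z.2‖ₑ ^ q ∂(stdGaussian E).prod (stdGaussian E)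
      ≤ ∫⁻ z, ENNReal.ofReal (π / 2) ^ (q - 1) * (∫⁻ θ in Set.Ioc 0 (π / 2),
          G (ContinuousLinearMap.rotation θ z)) ∂(stdGaussian E).prod (stdGaussian E) :=
        lintegral_mono hpt
    _ = ENNReal.ofReal (π / 2) ^ (q - 1) * ∫⁻ z, (∫⁻ θ in Set.Ioc 0 (π / 2),
          G (ContinuousLinearMap.rotation θ z)) ∂(stdGaussian E).prod (stdGaussian E) :=
        lintegral_const_mul _ (hGm.comp hrot.measurable).lintegral_prod_right'
    _ = ENNReal.ofReal (π / 2) ^ (q - 1) * (ENNReal.ofReal (π / 2) *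
          ∫⁻ z, G z ∂(stdGaussian E).prod (stdGaussian E)) := by
        rw [lintegral_lintegral_swap (f := fun z θ ↦ G (ContinuousLinearMap.rotation θ z))
          (hGm.comp hrot.measurable).aemeasurable]
        simp_rw [hGrot]
        simp [mul_comm]
    _ = _ := by
        rw [hGint, ← mul_assoc]
        congr 1
        have h0 : ENNReal.ofReal (π / 2) ≠ 0 := by simp [Real.pi_pos]
        conv_lhs => rw [← ENNReal.rpow_one (ENNReal.ofReal (π / 2)), ← ENNReal.rpow_mul, one_mul]
        rw [← ENNReal.rpow_add _ _ h0 (by simp), sub_add_cancel]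

/-- `L^q` Poincaré inequality for the standard Gaussian measure, for extended nonnegative
integrals. -/
lemma lintegral_enorm_sub_integral_rpow_le {f : E → ℝ} (hf : ContDiff ℝ 1 f)
    (hfi : Integrable f (stdGaussian E)) {q : ℝ} (hq : 1 < q) :
    ∫⁻ x, ‖f x - ∫ y, f y ∂stdGaussian E‖ₑ ^ q ∂stdGaussian E ≤
      ENNReal.ofReal (π / 2) ^ q * ((∫⁻ z, ‖z‖ₑ ^ q ∂gaussianReal 0 1) *
        ∫⁻ x, ‖fderiv ℝ f x‖ₑ ^ q ∂stdGaussian E) := by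
  have hm := hf.continuous.measurable
  refine le_trans ?_ (lintegral_enorm_sub_rpow_le hf hq)
  rw [lintegral_prod _ (by fun_prop)]
  refine lintegral_mono fun x ↦ ?_
  have h1 : f x - ∫ y, f y ∂stdGaussian E = ∫ y, (f x - f y) ∂stdGaussian E := by
    rw [integral_sub (integrable_const _) hfi]; simp
  rw [h1]
  refine (ENNReal.rpow_le_rpow (enorm_integral_le_lintegral_enorm _) (by linarith)).trans ?_
  refine (lintegral_rpow_le_measure_univ_rpow_mul _ hq (by fun_prop)).trans ?_
  simp

end StdGaussian

/-- The integral of a power of the norm as an extended nonnegative integral. -/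
lemma integral_norm_rpow_eq_toReal_lintegral {α F : Type*} [MeasurableSpace α]
    [NormedAddCommGroup F] {μ : Measure α} {g : α → F} (hg : AEStronglyMeasurable g μ) {q : ℝ}
    (hq : 0 ≤ q) : ∫ a, ‖g a‖ ^ q ∂μ = (∫⁻ a, ‖g a‖ₑ ^ q ∂μ).toReal := by
  rw [integral_eq_lintegral_of_nonneg_ae (Filter.Eventually.of_forall fun a ↦ by positivity)
    (hg.norm.aemeasurable.pow_const q).aestronglyMeasurable]
  congr 1
  refine lintegral_congr fun a ↦ ?_
  rw [← ENNReal.ofReal_rpow_of_nonneg (norm_nonneg _) hq, ofReal_norm]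

/-- `L^{2p}(γ)` Poincaré inequality with constant `(π/2) m(2p)^{1/(2p)}`, where
`m(2p)` is the `2p`-th absolute moment of the standard Gaussian distribution. -/
theorem lp_poincare (n : ℕ) (p : ℝ) (hp : 1 / 2 < p)
    (f : EuclideanSpace ℝ (Fin n) → ℝ) (hf : CPoly 1 n f) :
    (∫ x, |f x - ∫ y, f y ∂gaussianMeasure n| ^ (2 * p) ∂gaussianMeasure n) ^ (1 / (2 * p)) ≤
      (π / 2) * (∫ z, |z| ^ (2 * p) ∂ProbabilityTheory.gaussianReal 0 1) ^ (1 / (2 * p)) *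
        (∫ x, ‖gradient f x‖ ^ (2 * p) ∂gaussianMeasure n) ^ (1 / (2 * p)) := by
  have hq : 1 < 2 * p := by linarith
  have hq0 : 0 < 2 * p := by linarith
  rw [gaussianMeasure_eq_stdGaussian]
  obtain ⟨hc, hb⟩ := hf
  replace hc : ContDiff ℝ 1 f := by exact_mod_cast hc
  obtain ⟨C₀, m₀, h₀⟩ := hb 0 (by simp)
  obtain ⟨C₁, m₁, h₁⟩ := hb 1 le_rfl
  simp only [norm_iteratedFDeriv_zero] at h₀
  simp only [norm_iteratedFDeriv_one] at h₁
  have hfd : Continuous (fderiv ℝ f) := hc.continuous_fderiv (by simp)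
  have hfi : Integrable f (stdGaussian (EuclideanSpace ℝ (Fin n))) :=
    (memLp_stdGaussian_of_norm_le (q := 1) hc.continuous.aestronglyMeasurable h₀
      (by simp)).integrable le_rfl
  have hgrad : ∀ x, ‖gradient f x‖ = ‖fderiv ℝ f x‖ := fun x ↦ by simp [gradient]
  have hfin : ∀ {α F : Type} [MeasurableSpace α] [NormedAddCommGroup F] {μ : Measure α}
      {g : α → F}, MemLp g (ENNReal.ofReal (2 * p)) μ → ∫⁻ a, ‖g a‖ₑ ^ (2 * p) ∂μ ≠ ∞ := by
    intro α F _ _ μ g hg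
    have := lintegral_rpow_enorm_lt_top_of_eLpNorm_lt_top (by simpa using hq0) ENNReal.ofReal_ne_top hg.2
    rw [ENNReal.toReal_ofReal hq0.le] at this
    exact this.ne
  have hB := hfin (memLp_stdGaussian_of_norm_le (q := ENNReal.ofReal (2 * p))
    hfd.aestronglyMeasurable h₁ ENNReal.ofReal_ne_top)
  have hm := hfin (memLp_id_gaussianReal' (μ := 0) (v := 1) (ENNReal.ofReal (2 * p))
    ENNReal.ofReal_ne_top)
  have key := lintegral_enorm_sub_integral_rpow_le hc hfi hq
  have key' := ENNReal.toReal_mono (ENNReal.mul_ne_top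
    (ENNReal.rpow_ne_top_of_nonneg hq0.le ENNReal.ofReal_ne_top) (ENNReal.mul_ne_top hm hB)) key
  simp only [id] at key'
  rw [ENNReal.toReal_mul, ENNReal.toReal_mul, ← ENNReal.toReal_rpow,
    ENNReal.toReal_ofReal (by positivity),
    ← integral_norm_rpow_eq_toReal_lintegral (by fun_prop) hq0.le,
    ← integral_norm_rpow_eq_toReal_lintegral (by fun_prop) hq0.le,
    ← integral_norm_rpow_eq_toReal_lintegral (by fun_prop) hq0.le] at key'
  simp only [Real.norm_eq_abs] at key'
  simp_rw [hgrad]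
  have hm0 : 0 ≤ ∫ z, |z| ^ (2 * p) ∂gaussianReal 0 1 := integral_nonneg fun z ↦ by positivity
  have hB0 : 0 ≤ ∫ x, ‖fderiv ℝ f x‖ ^ (2 * p) ∂stdGaussian (EuclideanSpace ℝ (Fin n)) :=
    integral_nonneg fun z ↦ by positivity
  refine (Real.rpow_le_rpow (integral_nonneg fun x ↦ by positivity) key' (by positivity)).trans_eq ?_
  rw [Real.mul_rpow (by positivity) (by positivity), Real.mul_rpow hm0 hB0, ← Real.rpow_mul
    (by positivity), mul_one_div_cancel hq0.ne', Real.rpow_one, mul_assoc]
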